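/- The principal ideal v = α·O_L is a nonzero prime ideal of O_L, and in the v-adic completion L_v of L at this prime, none of the three elements -1, 2 + √2, and -(2 + √2) is a square. -/

import Mathlib

set_option synthInstance.maxHeartbeats 1000000
set_option maxHeartbeats 2000000

open IntermediateField Polynomial NumberField IsDedekindDomain HeightOneSpectrum

/-- The real fourth root of `2`. -/
noncomputable def alpha : ℝ := (2 : ℝ) ^ ((1 : ℝ) / 4)

lemma alpha_pow4 : alpha ^ 4 = 2 := by
  unfold alpha
  rw [← Real.rpow_natCast ((2:ℝ) ^ ((1:ℝ)/4)) 4, ← Real.rpow_mul (by norm_num)]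
  norm_num

/-- The number field `L = ℚ(2^{1/4})`, as a subfield of `ℝ`. -/
noncomputable def L : IntermediateField ℚ ℝ := ℚ⟮alpha⟯

noncomputable def alphaL : L := ⟨alpha, IntermediateField.mem_adjoin_simple_self ℚ alpha⟩

lemma alphaL_pow4 : alphaL ^ 4 = 2 := by
  apply Subtype.ext
  push_cast
  exact alpha_pow4

lemma alpha_int : IsIntegral ℚ alpha :=
  ⟨X ^ 4 - C 2, monic_X_pow_sub_C _ (by norm_num), by simp [alpha_pow4]⟩

instance : NumberField L := by
  haveI : FiniteDimensional ℚ L := IntermediateField.adjoin.finiteDimensional alpha_int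
  exact ⟨⟩

lemma alphaL_int : IsIntegral ℤ alphaL :=
  ⟨X ^ 4 - C 2, monic_X_pow_sub_C _ (by norm_num), by simp [alphaL_pow4]⟩

/-- `α` as an element of the ring of integers `O_L`. -/
noncomputable def alphaO : 𝓞 L := ⟨alphaL, alphaL_int⟩

noncomputable instance (v : HeightOneSpectrum (𝓞 L)) : Algebra L (v.adicCompletion L) :=
  instAlgebraAdicCompletion (𝓞 L) L v

/-! ### Abstract computation -/

section abstract_part

variable {A : Type*} [CommRing A] [IsDomain A]

lemma aux_step {p : A} (hp0 : p ≠ 0) (hp4 : p ^ 4 = 2) (hpu : ¬ IsUnit p)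
    (c0 c1 c2 c3 : ℤ) (t : A)
    (h : (c0 : A) + c1 * p + c2 * p ^ 2 + c3 * p ^ 3 = p * t) :
    ∃ k : ℤ, c0 = 2 * k ∧ (c1 : A) + c2 * p + c3 * p ^ 2 + k * p ^ 3 = t := by
  obtain ⟨k, hk | hk⟩ := Int.even_or_odd' c0
  · refine ⟨k, hk, mul_left_cancel₀ hp0 ?_⟩
    rw [← h, hk]
    push_cast
    linear_combination (k : A) * hp4
  · exfalso
    apply hpu
    refine IsUnit.of_mul_eq_one (t - c1 - c2 * p - c3 * p ^ 2 - k * p ^ 3) ?_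
    rw [hk] at h
    push_cast at h
    linear_combination -h - (k : A) * hp4

lemma aux_mod4 {p : A} (hp0 : p ≠ 0) (hp4 : p ^ 4 = 2) (hpu : ¬ IsUnit p)
    (c0 c1 c2 c3 : ℤ) (t : A)
    (h : (c0 : A) + c1 * p + c2 * p ^ 2 + c3 * p ^ 3 = 4 * t) :
    (4 ∣ c0 ∧ 4 ∣ c1) ∧ (4 ∣ c2 ∧ 4 ∣ c3) := by
  have h8 : (4 : A) * t = p * (p ^ 7 * t) := by
    linear_combination (-(p ^ 4 + 2) * t) * hp4
  rw [h8] at h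
  obtain ⟨k0, e0, h⟩ := aux_step hp0 hp4 hpu _ _ _ _ _ h
  rw [show p ^ 7 * t = p * (p ^ 6 * t) by ring] at h
  obtain ⟨k1, e1, h⟩ := aux_step hp0 hp4 hpu _ _ _ _ _ h
  rw [show p ^ 6 * t = p * (p ^ 5 * t) by ring] at h
  obtain ⟨k2, e2, h⟩ := aux_step hp0 hp4 hpu _ _ _ _ _ h
  rw [show p ^ 5 * t = p * (p ^ 4 * t) by ring] at h
  obtain ⟨k3, e3, h⟩ := aux_step hp0 hp4 hpu _ _ _ _ _ h
  rw [show p ^ 4 * t = p * (p ^ 3 * t) by ring] at h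
  obtain ⟨l0, f0, h⟩ := aux_step hp0 hp4 hpu _ _ _ _ _ h
  rw [show p ^ 3 * t = p * (p ^ 2 * t) by ring] at h
  obtain ⟨l1, f1, h⟩ := aux_step hp0 hp4 hpu _ _ _ _ _ h
  rw [show p ^ 2 * t = p * (p * t) by ring] at h
  obtain ⟨l2, f2, h⟩ := aux_step hp0 hp4 hpu _ _ _ _ _ h
  obtain ⟨l3, f3, h⟩ := aux_step hp0 hp4 hpu _ _ _ _ _ h
  omega

/-- If the residue ring is `𝔽₂`, every element is a digit expansion up to `p ^ 4 = 2`. -/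
lemma aux_square {p : A} (hp0 : p ≠ 0) (hp4 : p ^ 4 = 2) (hpu : ¬ IsUnit p)
    (hres : ∀ x : A, ∃ d : ℤ, ∃ y : A, (d = 0 ∨ d = 1) ∧ x = d + p * y)
    (x : A) (n m : ℤ) (h : x ^ 2 = n + m * p ^ 2) :
    ∃ a b c d : ℤ, ((a = 0 ∨ a = 1) ∧ (b = 0 ∨ b = 1)) ∧ ((c = 0 ∨ c = 1) ∧ (d = 0 ∨ d = 1)) ∧
      (4 ∣ a * a + 2 * (c * c) + 4 * (b * d) - n ∧ 4 ∣ 2 * (a * b) + 4 * (c * d)) ∧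
      (4 ∣ b * b + 2 * (a * c) + 2 * (d * d) - m ∧ 4 ∣ 2 * (a * d) + 2 * (b * c)) := by
  obtain ⟨a, x1, ha, hx⟩ := hres x
  obtain ⟨b, x2, hb, hx1⟩ := hres x1
  obtain ⟨c, x3, hc, hx2⟩ := hres x2
  obtain ⟨d, e, hd, hx3⟩ := hres x3
  refine ⟨a, b, c, d, ⟨ha, hb⟩, ⟨hc, hd⟩, ?_⟩
  have hxx : x = a + b * p + c * p ^ 2 + d * p ^ 3 + 2 * e := by
    rw [hx, hx1, hx2, hx3]
    linear_combination e * hp4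
  apply aux_mod4 hp0 hp4 hpu _ _ _ _ (-(e * (a + b * p + c * p ^ 2 + d * p ^ 3) + e ^ 2))
  rw [hxx] at h
  push_cast
  linear_combination h - ((c : A) ^ 2 + 2 * b * d + 2 * c * d * p + d ^ 2 * p ^ 2) * hp4

lemma aux_neg_one {p : A} (hp0 : p ≠ 0) (hp4 : p ^ 4 = 2) (hpu : ¬ IsUnit p)
    (hres : ∀ x : A, ∃ d : ℤ, ∃ y : A, (d = 0 ∨ d = 1) ∧ x = d + p * y)
    (x : A) : x ^ 2 ≠ -1 := by
  intro h
  obtain ⟨a, b, c, d, ⟨ha, hb⟩, ⟨hc, hd⟩, ⟨h0, h1⟩, h2, h3⟩ :=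
    aux_square hp0 hp4 hpu hres x (-1) 0 (by rw [h]; push_cast; ring)
  rcases ha with rfl | rfl <;> rcases hb with rfl | rfl <;> rcases hc with rfl | rfl <;>
    rcases hd with rfl | rfl <;> omega

lemma aux_pos {p : A} (hp0 : p ≠ 0) (hp4 : p ^ 4 = 2) (hpu : ¬ IsUnit p)
    (hres : ∀ x : A, ∃ d : ℤ, ∃ y : A, (d = 0 ∨ d = 1) ∧ x = d + p * y)
    (x : A) : x ^ 2 ≠ 1 + p ^ 2 := by
  intro h
  obtain ⟨a, b, c, d, ⟨ha, hb⟩, ⟨hc, hd⟩, ⟨h0, h1⟩, h2, h3⟩ :=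
    aux_square hp0 hp4 hpu hres x 1 1 (by rw [h]; push_cast; ring)
  rcases ha with rfl | rfl <;> rcases hb with rfl | rfl <;> rcases hc with rfl | rfl <;>
    rcases hd with rfl | rfl <;> omega

lemma aux_neg {p : A} (hp0 : p ≠ 0) (hp4 : p ^ 4 = 2) (hpu : ¬ IsUnit p)
    (hres : ∀ x : A, ∃ d : ℤ, ∃ y : A, (d = 0 ∨ d = 1) ∧ x = d + p * y)
    (x : A) : x ^ 2 ≠ -(1 + p ^ 2) := by
  intro h
  obtain ⟨a, b, c, d, ⟨ha, hb⟩, ⟨hc, hd⟩, ⟨h0, h1⟩, h2, h3⟩ :=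
    aux_square hp0 hp4 hpu hres x (-1) (-1) (by rw [h]; push_cast; ring)
  rcases ha with rfl | rfl <;> rcases hb with rfl | rfl <;> rcases hc with rfl | rfl <;>
    rcases hd with rfl | rfl <;> omega

end abstract_part

/-! ### The prime `(α)` -/

lemma alphaO_pow4 : alphaO ^ 4 = 2 := by
  apply RingOfIntegers.ext
  push_cast
  exact alphaL_pow4

lemma alphaO_ne_zero : alphaO ≠ 0 := by
  intro h
  have := alphaO_pow4
  rw [h] at this
  norm_num at this

lemma finrank_L_le : Module.finrank ℚ L ≤ 4 := by
  unfold L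
  rw [IntermediateField.adjoin.finrank alpha_int]
  have hm : (X ^ 4 - C 2 : ℚ[X]).Monic := monic_X_pow_sub_C _ (by norm_num)
  have h := natDegree_le_natDegree (minpoly.degree_le_of_ne_zero ℚ alpha hm.ne_zero
    (by simp [alpha_pow4]))
  rwa [natDegree_X_pow_sub_C] at h

lemma absNorm_alpha : Ideal.absNorm (Ideal.span {alphaO}) = 2 := by
  have h4 : (Ideal.absNorm (Ideal.span {alphaO})) ^ 4 = 2 ^ Module.finrank ℚ L := by
    rw [Ideal.absNorm_span_singleton, ← Int.natAbs_pow, ← map_pow, alphaO_pow4]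
    have : (2 : 𝓞 L) = algebraMap ℤ (𝓞 L) 2 := by simp
    rw [this, Algebra.norm_algebraMap, RingOfIntegers.rank, Int.natAbs_pow]
    rfl
  have hle := finrank_L_le
  have hpos : 0 < Module.finrank ℚ L := Module.finrank_pos
  generalize Ideal.absNorm (Ideal.span {alphaO}) = N at *
  generalize Module.finrank ℚ L = n at *
  have hN : N ≤ 2 := by
    by_contra! hc
    have : 3 ^ 4 ≤ N ^ 4 := Nat.pow_le_pow_left hc 4
    have := Nat.pow_le_pow_right (show 0 < 2 by norm_num) hle
    omega
  interval_cases n <;> interval_cases N <;> simp_all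

lemma alpha_isPrime : (Ideal.span {alphaO}).IsPrime := by
  apply Ideal.isPrime_of_irreducible_absNorm
  rw [absNorm_alpha]
  exact Nat.prime_two

/-- The prime `(α)`. -/
noncomputable def primeV : HeightOneSpectrum (𝓞 L) :=
  ⟨Ideal.span {alphaO}, alpha_isPrime, by simpa using alphaO_ne_zero⟩

lemma residue_two (a : 𝓞 L) : a ∈ primeV.asIdeal ∨ a - 1 ∈ primeV.asIdeal := by
  have hcard : Nat.card (𝓞 L ⧸ primeV.asIdeal) = 2 := by
    have := absNorm_alpha
    rwa [Ideal.absNorm_apply, Submodule.cardQuot_apply] at this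
  have hne : (1 : 𝓞 L ⧸ primeV.asIdeal) ≠ 0 := by
    rw [← map_one (Ideal.Quotient.mk _), Ne, Ideal.Quotient.eq_zero_iff_mem]
    exact (Ideal.ne_top_iff_one _).1 primeV.isPrime.ne_top
  obtain ⟨x, y, -, hxy⟩ := Nat.card_eq_two_iff.1 hcard
  have key : ∀ z, z = x ∨ z = y := fun z => by
    have : z ∈ ({x, y} : Set _) := hxy ▸ Set.mem_univ z
    simpa using this
  rw [← Ideal.Quotient.eq_zero_iff_mem, ← Ideal.Quotient.eq_zero_iff_mem, map_sub, map_one,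
    sub_eq_zero]
  rcases key 0 with h0 | h0 <;> rcases key 1 with h1 | h1 <;>
    rcases key (Ideal.Quotient.mk primeV.asIdeal a) with h2 | h2 <;>
    simp_all

lemma val_alpha : primeV.valuation L alphaL = WithZero.exp (-1 : ℤ) := by
  have h := primeV.valuation_of_algebraMap (K := L) alphaO
  rw [intValuation_singleton primeV alphaO_ne_zero rfl] at h
  exact h

lemma val_alg (k : L) : Valued.v (algebraMap L (primeV.adicCompletion L) k) =
    primeV.valuation L k :=
  valuedAdicCompletion_eq_valuation' primeV k

lemma residue_complete (x : primeV.adicCompletion L) (hx : Valued.v x ≤ 1) :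
    ∃ d : ℤ, (d = 0 ∨ d = 1) ∧ Valued.v (x - d) < 1 := by
  obtain ⟨y, hy⟩ : ∃ y : L, Valued.v (algebraMap L (primeV.adicCompletion L) y - x) < 1 := by
    have hb : {z : primeV.adicCompletion L | Valued.v (z - x) < 1} ∈ nhds x := by
      rw [Valued.mem_nhds]
      refine ⟨1, fun z hz => ?_⟩
      simpa using hz
    obtain ⟨z, hz, y, rfl⟩ := (mem_closure_iff_nhds.1 (denseRange_algebraMap L primeV x)) _ hb
    exact ⟨y, hz⟩
  have hy1 : primeV.valuation L y ≤ 1 := by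
    rw [← val_alg]
    have := Valued.v.map_add (algebraMap L (primeV.adicCompletion L) y - x) x
    rw [sub_add_cancel] at this
    exact this.trans (max_le hy.le hx)
  obtain ⟨a, ha⟩ := exists_valuation_sub_lt_of_integer primeV hy1 1
  have ha' : Valued.v (algebraMap L (primeV.adicCompletion L) (algebraMap (𝓞 L) L a) -
      algebraMap L (primeV.adicCompletion L) y) < 1 := by
    rw [← map_sub, val_alg]
    exact ha
  obtain ⟨d, hd, hd'⟩ : ∃ d : ℤ, (d = 0 ∨ d = 1) ∧ a - d ∈ primeV.asIdeal := by
    rcases residue_two a with h | h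
    · exact ⟨0, Or.inl rfl, by simpa using h⟩
    · exact ⟨1, Or.inr rfl, by simpa using h⟩
  refine ⟨d, hd, ?_⟩
  have hd2 : Valued.v (algebraMap L (primeV.adicCompletion L) (algebraMap (𝓞 L) L (a - d))) < 1 := by
    rw [val_alg]
    exact (valuation_lt_one_iff_mem primeV _).2 hd'
  rw [map_sub, map_sub, map_intCast, map_intCast] at hd2
  have e : x - d = (algebraMap L (primeV.adicCompletion L) (algebraMap (𝓞 L) L a) - d) -
    ((algebraMap L (primeV.adicCompletion L) (algebraMap (𝓞 L) L a) -
      algebraMap L (primeV.adicCompletion L) y) +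
      (algebraMap L (primeV.adicCompletion L) y - x)) := by ring
  rw [e]
  exact Valued.v.map_sub_lt hd2 (Valued.v.map_add_lt ha' hy)

/-- `α` in the completed ring of integers. -/
noncomputable def alphaV : primeV.adicCompletionIntegers L :=
  ⟨algebraMap L (primeV.adicCompletion L) alphaL, by
    rw [mem_adicCompletionIntegers, val_alg, val_alpha, ← WithZero.exp_zero, WithZero.exp_le_exp]
    norm_num⟩

lemma val_alphaV : Valued.v (alphaV : primeV.adicCompletion L) = WithZero.exp (-1 : ℤ) := by
  rw [← val_alpha, ← val_alg]
  rfl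

lemma alphaV_ne_zero : (alphaV : primeV.adicCompletion L) ≠ 0 := by
  intro h
  have := val_alphaV
  rw [h, map_zero] at this
  exact WithZero.exp_ne_zero this.symm

lemma alphaV_pow4 : alphaV ^ 4 = 2 := by
  apply Subtype.ext
  change (algebraMap L (primeV.adicCompletion L) alphaL) ^ 4 = 2
  rw [← map_pow, alphaL_pow4, map_ofNat]

lemma alphaV_not_unit : ¬ IsUnit alphaV := by
  rw [adicCompletionIntegers.isUnit_iff_valued_eq_one, val_alphaV, ← WithZero.exp_zero]
  intro h
  have := WithZero.exp_injective h
  norm_num at this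

lemma residue_V (x : primeV.adicCompletionIntegers L) :
    ∃ d : ℤ, ∃ y : primeV.adicCompletionIntegers L, (d = 0 ∨ d = 1) ∧ x = d + alphaV * y := by
  obtain ⟨d, hd, h⟩ := residue_complete x x.2
  refine ⟨d, ⟨((x : primeV.adicCompletion L) - d) / alphaV, ?_⟩, hd, ?_⟩
  · rw [mem_adicCompletionIntegers, map_div₀, val_alphaV, WithZero.exp_neg, div_inv_eq_mul]
    by_contra! hc
    have h2 := (WithZero.lt_mul_exp_iff_le
      (x := 1) (y := Valued.v ((x : primeV.adicCompletion L) - d)) (by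
        intro h0
        rw [h0, zero_mul] at hc
        exact absurd hc (by simp))).1 hc
    exact absurd h (not_lt.2 h2)
  · apply Subtype.ext
    push_cast
    rw [mul_div_cancel₀ _ alphaV_ne_zero]
    ring

lemma mem_of_sq {x : primeV.adicCompletion L} (y : primeV.adicCompletionIntegers L)
    (h : x ^ 2 = y) : x ∈ primeV.adicCompletionIntegers L := by
  rw [mem_adicCompletionIntegers]
  have h1 : Valued.v (x ^ 2) ≤ 1 := by
    rw [h]; exact y.2
  rw [map_pow] at h1
  exact (pow_le_one_iff (by norm_num)).1 h1

lemma alphaV_ne_zero' : alphaV ≠ 0 := fun h => alphaV_ne_zero (by rw [h]; rfl)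

/-- The principal ideal `v = α·O_L` is a nonzero prime ideal of `O_L` (i.e. it is a point of
the height-one spectrum of the Dedekind domain `O_L`), and in the `v`-adic completion `L_v`
of `L` none of the three elements `-1`, `2 + √2`, `-(2 + √2)` is a square. -/
theorem stmt5 :
    ∃ v : HeightOneSpectrum (𝓞 L), v.asIdeal = Ideal.span {alphaO} ∧
      ¬ IsSquare (algebraMap L (v.adicCompletion L) (-1)) ∧
      ¬ IsSquare (algebraMap L (v.adicCompletion L) ((2 : L) + alphaL ^ 2)) ∧
      ¬ IsSquare (algebraMap L (v.adicCompletion L) (-((2 : L) + alphaL ^ 2))) := by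
  refine ⟨primeV, rfl, ?_, ?_, ?_⟩
  · rintro ⟨x, hx⟩
    rw [map_neg, map_one] at hx
    have h : x ^ 2 = ((-1 : primeV.adicCompletionIntegers L) : primeV.adicCompletion L) := by
      push_cast; rw [hx]; ring
    exact aux_neg_one alphaV_ne_zero' alphaV_pow4 alphaV_not_unit residue_V ⟨x, mem_of_sq _ h⟩
      (Subtype.ext h)
  · rintro ⟨x, hx⟩
    have e : (2 : L) + alphaL ^ 2 = alphaL ^ 2 * (1 + alphaL ^ 2) := by
      linear_combination -alphaL_pow4
    have h : (x / alphaV) ^ 2 =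
        ((1 + alphaV ^ 2 : primeV.adicCompletionIntegers L) : primeV.adicCompletion L) := by
      rw [div_pow, div_eq_iff (pow_ne_zero 2 alphaV_ne_zero), pow_two x, ← hx, e, map_mul, map_add,
        map_pow, map_one, mul_comm]
      rfl
    exact aux_pos alphaV_ne_zero' alphaV_pow4 alphaV_not_unit residue_V
      ⟨x / alphaV, mem_of_sq _ h⟩ (Subtype.ext h)
  · rintro ⟨x, hx⟩
    have e : -((2 : L) + alphaL ^ 2) = alphaL ^ 2 * -(1 + alphaL ^ 2) := by
      linear_combination alphaL_pow4
    have h : (x / alphaV) ^ 2 =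
        ((-(1 + alphaV ^ 2) : primeV.adicCompletionIntegers L) : primeV.adicCompletion L) := by
      rw [div_pow, div_eq_iff (pow_ne_zero 2 alphaV_ne_zero), pow_two x, ← hx, e, map_mul, map_neg,
        map_add, map_pow, map_one, mul_comm]
      rfl
    exact aux_neg alphaV_ne_zero' alphaV_pow4 alphaV_not_unit residue_V
      ⟨x / alphaV, mem_of_sq _ h⟩ (Subtype.ext h)
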